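/- Under the hypotheses of the Fano–packing lower bound (J uniform on {1,…,M} with M ≥ 2 and independent of S, U = u^{(J)}, Y conditionally independent of J given (U,S), and a Δ-separable codebook with loss–index link), suppose additionally that I(U;Y|S) ≤ C̄ for a constant C̄ ≥ 0 and that some decoder π satisfies E[ℓ(U, π(Y,S))] ≤ r for a constant r ∈ [0,1]. Then C̄ ≥ (1 − r/(ε + Δ)) · log M − log 2. -/

import Mathlib

open MeasureTheory Real

/-- Shannon entropy (natural log) of a random variable taking values in a finite set. -/
noncomputable def entropy {Ω α : Type*} [MeasurableSpace Ω] [Fintype α]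
    (μ : Measure Ω) (X : Ω → α) : ℝ :=
  ∑ a : α, Real.negMulLog (μ (X ⁻¹' {a})).toReal

/-- Conditional mutual information I(X;Y|Z) = H(X|Z) + H(Y|Z) - H(X,Y|Z). -/
noncomputable def condMutualInfo {Ω α β γ : Type*} [MeasurableSpace Ω]
    [Fintype α] [Fintype β] [Fintype γ]
    (μ : Measure Ω) (X : Ω → α) (Y : Ω → β) (Z : Ω → γ) : ℝ :=
  entropy μ (fun ω => (X ω, Z ω)) + entropy μ (fun ω => (Y ω, Z ω))
    - entropy μ (fun ω => (X ω, Y ω, Z ω)) - entropy μ Z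

lemma entropy_comp_injective {Ω α β : Type*} [MeasurableSpace Ω] [Fintype α] [Fintype β]
    (μ : Measure Ω) (X : Ω → α) {f : α → β} (hf : f.Injective) :
    entropy μ (fun ω => f (X ω)) = entropy μ X := by
  unfold entropy
  refine (Fintype.sum_of_injective f hf _ _ (fun b hb => ?_) (fun x => ?_)).symm
  · have : (fun ω => f (X ω)) ⁻¹' {b} = ∅ := by
      ext ω
      simpa using fun h => hb ⟨X ω, h⟩
    simp [this]
  · congr 3
    ext ω
    simp [hf.eq_iff]

lemma sum_measureReal_fiber {Ω α : Type*} [MeasurableSpace Ω] [Fintype α] [MeasurableSpace α]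
    [MeasurableSingletonClass α] (μ : Measure Ω) [IsFiniteMeasure μ] {X : Ω → α}
    (hX : Measurable X) {A : Set Ω} (hA : MeasurableSet A) :
    ∑ x, μ.real (X ⁻¹' {x} ∩ A) = μ.real A := by
  rw [← measureReal_biUnion_finset]
  · congr 1
    ext ω
    simp
  · intro x _ y _ hxy
    refine Set.disjoint_left.2 fun ω h₁ h₂ => hxy ?_
    exact h₁.1.symm.trans h₂.1
  · exact fun x _ => (hX (measurableSet_singleton x)).inter hA

lemma sum_measureReal_preimage_singleton {Ω α : Type*} [MeasurableSpace Ω] [Fintype α]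
    [MeasurableSpace α] [MeasurableSingletonClass α] (μ : Measure Ω) [IsProbabilityMeasure μ]
    {X : Ω → α} (hX : Measurable X) : ∑ x, μ.real (X ⁻¹' {x}) = 1 := by
  simpa using sum_measureReal_fiber μ hX MeasurableSet.univ

/-- Pointwise form of Gibbs' inequality. -/
lemma negMulLog_add_mul_log_le {p P q : ℝ} (hp : 0 ≤ p) (hpP : p ≤ P) (hq : 0 < q) :
    negMulLog p + p * log P ≤ -(p * log q) + (q * P - p) := by
  rcases hp.eq_or_lt with rfl | hp
  · simpa using mul_nonneg hq.le hpP
  have hP : 0 < P := hp.trans_le hpP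
  have h := log_le_sub_one_of_pos (show 0 < q * P / p by positivity)
  rw [log_div (by positivity) hp.ne', log_mul hq.ne' hP.ne'] at h
  have h' := mul_le_mul_of_nonneg_left h hp.le
  have e : p * (q * P / p - 1) = q * P - p := by field_simp
  rw [e] at h'
  unfold negMulLog
  linarith

/-- Fano's inequality for an estimator `g Z` of `X`. -/
lemma entropy_prod_sub_entropy_le {Ω α β : Type*} [MeasurableSpace Ω]
    [Fintype α] [MeasurableSpace α] [MeasurableSingletonClass α]
    [Fintype β] [MeasurableSpace β] [MeasurableSingletonClass β]
    (μ : Measure Ω) [IsProbabilityMeasure μ] {X : Ω → α} {Z : Ω → β}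
    (hX : Measurable X) (hZ : Measurable Z) (g : β → α) :
    entropy μ (fun ω => (X ω, Z ω)) - entropy μ Z
      ≤ log 2 + μ.real {ω | g (Z ω) ≠ X ω} * log (Fintype.card α) := by
  classical
  obtain ⟨ω₀⟩ := nonempty_of_isProbabilityMeasure μ
  have : Nonempty α := ⟨X ω₀⟩
  have hM : (0 : ℝ) < Fintype.card α := by exact_mod_cast Fintype.card_pos
  set M : ℝ := (Fintype.card α : ℝ)
  set p : α → β → ℝ := fun x z => μ.real ((fun ω => (X ω, Z ω)) ⁻¹' {(x, z)}) with hp_def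
  set P : β → ℝ := fun z => μ.real (Z ⁻¹' {z}) with hP_def
  set q : α → β → ℝ := fun x z => if g z = x then 1 / 2 else 1 / (2 * M) with hq_def
  have hXZ : Measurable fun ω => (X ω, Z ω) := hX.prodMk hZ
  have hp_inter (x : α) (z : β) : p x z = μ.real (X ⁻¹' {x} ∩ Z ⁻¹' {z}) := by
    simp only [hp_def]
    congr 1
    ext ω
    simp
  have hmarg (z : β) : ∑ x, p x z = P z := by
    simp only [hp_inter]
    exact sum_measureReal_fiber μ hX (hZ (measurableSet_singleton z))
  have hpP (x : α) (z : β) : p x z ≤ P z := by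
    rw [hp_inter]
    exact measureReal_mono Set.inter_subset_right
  have hq (x : α) (z : β) : 0 < q x z := by
    simp only [hq_def]
    split_ifs <;> positivity
  have hqsum (z : β) : ∑ x, q x z ≤ 1 := by
    calc ∑ x, q x z ≤ ∑ x, ((if g z = x then 1 / 2 else 0) + 1 / (2 * M)) := by
          refine Finset.sum_le_sum fun x _ => ?_
          simp only [hq_def]
          split_ifs
          · have : 0 < 1 / (2 * M) := by positivity
            linarith
          · simp
      _ = 1 := by
          rw [Finset.sum_add_distrib, Finset.sum_ite_eq]
          simp only [Finset.mem_univ, if_true, Finset.sum_const, Finset.card_univ, nsmul_eq_mul]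
          change 1 / 2 + M * (1 / (2 * M)) = 1
          field_simp
          norm_num
  have hlogq (x : α) (z : β) : -log (q x z) = log 2 + if g z = x then 0 else log M := by
    simp only [hq_def]
    split_ifs
    · simp
    · rw [one_div, log_inv, log_mul two_ne_zero hM.ne']
      ring
  have htotal : ∑ z, ∑ x, p x z = 1 := by
    simp only [hmarg]
    exact sum_measureReal_preimage_singleton μ hZ
  have herr : ∑ z, ∑ x, (if g z = x then 0 else p x z) = μ.real {ω | g (Z ω) ≠ X ω} := by
    have hmeas : MeasurableSet {ω | g (Z ω) ≠ X ω} :=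
      hXZ (Set.toFinite {w : α × β | g w.2 ≠ w.1}).measurableSet
    rw [← sum_measureReal_fiber μ hXZ hmeas, Fintype.sum_prod_type, Finset.sum_comm]
    refine Finset.sum_congr rfl fun x _ => Finset.sum_congr rfl fun z _ => ?_
    split_ifs with h
    · have : (fun ω => (X ω, Z ω)) ⁻¹' {(x, z)} ∩ {ω | g (Z ω) ≠ X ω} = ∅ := by
        ext ω
        simp only [Set.mem_inter_iff, Set.mem_preimage, Set.mem_singleton_iff, Prod.mk.injEq,
          Set.mem_ofPred_eq, Set.mem_empty_iff_false, iff_false]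
        rintro ⟨⟨rfl, rfl⟩, h'⟩
        exact h' h
      simp [this]
    · simp only [hp_def]
      congr 1
      ext ω
      simp only [Set.mem_inter_iff, Set.mem_preimage, Set.mem_singleton_iff, Prod.mk.injEq,
        Set.mem_ofPred_eq]
      refine ⟨fun h' => ⟨h', ?_⟩, fun h' => h'.1⟩
      rwa [h'.1, h'.2]
  have hcond : entropy μ (fun ω => (X ω, Z ω)) - entropy μ Z
      = ∑ z, ∑ x, (negMulLog (p x z) + p x z * log (P z)) := by
    have h₁ : entropy μ (fun ω => (X ω, Z ω)) = ∑ z, ∑ x, negMulLog (p x z) := by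
      rw [Finset.sum_comm, ← Fintype.sum_prod_type']
      rfl
    have h₂ : entropy μ Z = -∑ z, ∑ x, p x z * log (P z) := by
      simp only [← Finset.sum_mul, hmarg, ← Finset.sum_neg_distrib]
      exact Finset.sum_congr rfl fun z _ => by simp [negMulLog, hP_def, Measure.real]
    rw [h₁, h₂, sub_neg_eq_add]
    simp only [Finset.sum_add_distrib]
  have hgibbs (z : β) : ∑ x, (q x z * P z - p x z) ≤ 0 := by
    rw [Finset.sum_sub_distrib, hmarg, ← Finset.sum_mul]
    nlinarith [hqsum z, show 0 ≤ P z from measureReal_nonneg]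
  calc entropy μ (fun ω => (X ω, Z ω)) - entropy μ Z
      = ∑ z, ∑ x, (negMulLog (p x z) + p x z * log (P z)) := hcond
    _ ≤ ∑ z, ∑ x, (-(p x z * log (q x z)) + (q x z * P z - p x z)) := by
        refine Finset.sum_le_sum fun z _ => Finset.sum_le_sum fun x _ => ?_
        exact negMulLog_add_mul_log_le measureReal_nonneg (hpP x z) (hq x z)
    _ ≤ ∑ z, ∑ x, -(p x z * log (q x z)) := by
        refine Finset.sum_le_sum fun z _ => ?_
        rw [Finset.sum_add_distrib]
        linarith [hgibbs z]
    _ = ∑ z, ∑ x, (p x z * log 2 + (if g z = x then 0 else p x z) * log M) := by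
        refine Finset.sum_congr rfl fun z _ => Finset.sum_congr rfl fun x _ => ?_
        rw [← mul_neg, hlogq]
        split_ifs <;> ring
    _ = log 2 + μ.real {ω | g (Z ω) ≠ X ω} * log M := by
        simp only [Finset.sum_add_distrib, ← Finset.sum_mul, htotal, herr, one_mul]

lemma entropy_prod_of_uniform_of_indep {Ω β : Type*} [MeasurableSpace Ω]
    [Fintype β] [MeasurableSpace β] [MeasurableSingletonClass β]
    (μ : Measure Ω) [IsProbabilityMeasure μ] {M : ℕ} (hM : M ≠ 0) {J : Ω → Fin M} {S : Ω → β}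
    (hS : Measurable S) (hunif : ∀ j : Fin M, μ (J ⁻¹' {j}) = 1 / M)
    (hindep : ∀ (j : Fin M) (s : β),
      μ {ω | J ω = j ∧ S ω = s} = μ (J ⁻¹' {j}) * μ (S ⁻¹' {s})) :
    entropy μ (fun ω => (J ω, S ω)) = log M + entropy μ S := by
  have hM' : (M : ℝ) ≠ 0 := by exact_mod_cast hM
  have hatom (j : Fin M) (s : β) : (μ ((fun ω => (J ω, S ω)) ⁻¹' {(j, s)})).toReal
      = (M : ℝ)⁻¹ * μ.real (S ⁻¹' {s}) := by
    have : (fun ω => (J ω, S ω)) ⁻¹' {(j, s)} = {ω | J ω = j ∧ S ω = s} := by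
      ext ω
      simp
    rw [this, hindep, hunif]
    simp [Measure.real]
  have hsum := sum_measureReal_preimage_singleton μ hS
  unfold entropy
  rw [Fintype.sum_prod_type]
  simp only [hatom, negMulLog_mul, Finset.sum_add_distrib, ← Finset.sum_mul, ← Finset.mul_sum,
    hsum, Finset.sum_const, Finset.card_univ, Fintype.card_fin, nsmul_eq_mul]
  simp only [negMulLog, log_inv, Measure.real]
  field_simp

/-- Proposition 7.2 (Necessary capacity for a target risk): under the hypotheses of the
Fano–packing lower bound, if additionally `I(U;Y|S) ≤ C̄` and some decoder achieves
`E[ℓ(U, π(Y,S))] ≤ r`, then `C̄ ≥ (1 − r/(ε+Δ))·log M − log 2`. Setup: for a Δ-separable codebook with loss–index link,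
`J` uniform on `{1,…,M}` (`M ≥ 2`) independent of `S`, `U = u^{(J)}`, and `Y` conditionally
independent of `J` given `(U,S)`, every decoder `π` satisfies
`R_mix(π) = E[ℓ(U, π(Y,S))] ≥ (ε+Δ)·max{1 − (I(U;Y|S) + log 2)/log M, 0}`. -/
theorem necessary_capacity_for_target_risk
    {Ω 𝒰 𝒜 𝒴 𝒮 : Type*} [MeasurableSpace Ω]
    [Fintype 𝒰] [MeasurableSpace 𝒰] [MeasurableSingletonClass 𝒰]
    [MeasurableSpace 𝒜]
    [Fintype 𝒴] [MeasurableSpace 𝒴] [MeasurableSingletonClass 𝒴]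
    [Fintype 𝒮] [MeasurableSpace 𝒮] [MeasurableSingletonClass 𝒮]
    (μ : Measure Ω) [IsProbabilityMeasure μ]
    (M : ℕ) (hM : 2 ≤ M)
    (J : Ω → Fin M) (Y : Ω → 𝒴) (S : Ω → 𝒮)
    (hJ : Measurable J) (hY : Measurable Y) (hS : Measurable S)
    (hunif : ∀ j : Fin M, μ (J ⁻¹' {j}) = 1 / M)
    (hindep : ∀ (j : Fin M) (s : 𝒮),
      μ {ω | J ω = j ∧ S ω = s} = μ (J ⁻¹' {j}) * μ (S ⁻¹' {s}))
    (u : Fin M → 𝒰) (a : Fin M → 𝒜)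
    (hcondindep : ∀ (j : Fin M) (y : 𝒴) (v : 𝒰) (s : 𝒮),
      μ {ω | J ω = j ∧ Y ω = y ∧ u (J ω) = v ∧ S ω = s} * μ {ω | u (J ω) = v ∧ S ω = s}
        = μ {ω | J ω = j ∧ u (J ω) = v ∧ S ω = s}
          * μ {ω | Y ω = y ∧ u (J ω) = v ∧ S ω = s})
    (ℓ : 𝒰 → 𝒜 → ℝ) (hℓmeas : Measurable (Function.uncurry ℓ))
    (hℓ01 : ∀ x b, ℓ x b ∈ Set.Icc (0 : ℝ) 1)
    (ε Δ : ℝ) (hε : 0 ≤ ε) (hΔ : 0 < Δ) (hεΔ : ε + Δ ≤ 1)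
    (hgood : ∀ i, ℓ (u i) (a i) ≤ ε)
    (φ : 𝒜 → 𝒮 → Fin M) (hφ : Measurable (Function.uncurry φ))
    (hlink : ∀ (i : Fin M) (s : 𝒮) (b : 𝒜), φ b s ≠ i → ε + Δ ≤ ℓ (u i) b)
    (dec : 𝒴 → 𝒮 → 𝒜) (hdec : Measurable (Function.uncurry dec))
    (C : ℝ) (hC : 0 ≤ C)
    (hcap : condMutualInfo μ (fun ω => u (J ω)) Y S ≤ C)
    (r : ℝ) (hr : r ∈ Set.Icc (0 : ℝ) 1)
    (hrisk : ∫ ω, ℓ (u (J ω)) (dec (Y ω) (S ω)) ∂μ ≤ r) :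
    (1 - r / (ε + Δ)) * Real.log M - Real.log 2 ≤ C := by
  have hεΔ₀ : 0 < ε + Δ := by linarith
  obtain ⟨ω₀⟩ := nonempty_of_isProbabilityMeasure μ
  have hu : u.Injective := by
    intro i j hij
    by_contra hne
    have hlow : ε + Δ ≤ ℓ (u i) (a i) := by
      by_cases h : φ (a i) (S ω₀) = i
      · rw [hij]
        exact hlink j (S ω₀) (a i) (by rwa [h])
      · exact hlink i (S ω₀) (a i) h
    linarith [hgood i]
  have hYS : Measurable fun ω => (Y ω, S ω) := hY.prodMk hS
  have hFano := entropy_prod_sub_entropy_le μ hJ hYS fun z => φ (dec z.1 z.2) z.2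
  rw [Fintype.card_fin] at hFano
  have hUS : entropy μ (fun ω => (u (J ω), S ω)) = log M + entropy μ S := by
    rw [← entropy_prod_of_uniform_of_indep μ (by omega) hS hunif hindep]
    exact entropy_comp_injective μ (fun ω => (J ω, S ω)) (f := fun w => (u w.1, w.2))
      (hu.prodMap Function.injective_id)
  have hUYS : entropy μ (fun ω => (u (J ω), Y ω, S ω))
      = entropy μ (fun ω => (J ω, Y ω, S ω)) :=
    entropy_comp_injective μ (fun ω => (J ω, Y ω, S ω)) (f := fun w => (u w.1, w.2))
      (hu.prodMap Function.injective_id)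
  unfold condMutualInfo at hcap
  rw [hUS, hUYS] at hcap
  have hlossmeas : Measurable fun ω => ℓ (u (J ω)) (dec (Y ω) (S ω)) :=
    hℓmeas.comp (((measurable_of_finite u).comp hJ).prodMk (hdec.comp hYS))
  have hint : Integrable (fun ω => ℓ (u (J ω)) (dec (Y ω) (S ω))) μ :=
    Integrable.of_bound hlossmeas.aestronglyMeasurable 1 (.of_forall fun ω => by
      rw [Real.norm_of_nonneg (hℓ01 _ _).1]
      exact (hℓ01 _ _).2)
  have hmarkov := mul_meas_ge_le_integral_of_nonneg
    (.of_forall fun ω => (hℓ01 (u (J ω)) (dec (Y ω) (S ω))).1) hint (ε + Δ)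
  have hmono : μ.real {ω | φ (dec (Y ω) (S ω)) (S ω) ≠ J ω}
      ≤ μ.real {ω | ε + Δ ≤ ℓ (u (J ω)) (dec (Y ω) (S ω))} :=
    measureReal_mono fun ω hω => hlink (J ω) (S ω) _ hω
  have herr : μ.real {ω | φ (dec (Y ω) (S ω)) (S ω) ≠ J ω} ≤ r / (ε + Δ) := by
    rw [le_div_iff₀' hεΔ₀]
    exact (mul_le_mul_of_nonneg_left hmono hεΔ₀.le).trans (hmarkov.trans hrisk)
  have hlogM : 0 ≤ log M := log_natCast_nonneg M
  have := mul_le_mul_of_nonneg_right herr hlogM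
  linarith
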